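/- arXiv:1911.00782 — 4 statements merged into one kernel-verified Lean document; each statement's English description precedes it below -/
import Mathlib

section
/- Let d ≥ 3 be an integer and σ ≥ 0 a real number, and let ε be a standard Gaussian random vector in ℝ^{ZMod d}. Then the expected squared Euclidean norm of the Laplacian-smoothed noise satisfies E[‖A_σ⁻¹·ε‖₂²] = Σ_{j=0}^{d−1} 1/(1 + 2σ − 2σ·cos(2πj/d))², i.e., the integral with respect to γ of ε ↦ ‖A_σ⁻¹·ε‖₂² equals Σ_{j=0}^{d−1} μ_j⁻². -/
open Matrix MeasureTheory ProbabilityTheory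

/-- The Laplacian smoothing matrix `A_σ = I - σL`. -/
noncomputable def Aσ (d : ℕ) (σ : ℝ) : Matrix (ZMod d) (ZMod d) ℝ :=
  Matrix.of fun i j => if i = j then 1 + 2 * σ else if i = j + 1 ∨ j = i + 1 then -σ else 0

/-- The standard Gaussian measure on `ℝ^{ZMod d}`. -/
noncomputable def stdGaussian (d : ℕ) [NeZero d] : Measure (ZMod d → ℝ) :=
  Measure.pi fun _ => gaussianReal 0 1

lemma gauss_coord (d : ℕ) [NeZero d] (c : ℝ) (k : ZMod d) :
    MemLp (fun ε : ZMod d → ℝ => c * ε k) 2 (Measure.pi fun _ => gaussianReal 0 1) := by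
  have h : MemLp (fun x : ℝ => c * x) 2 (gaussianReal 0 1) :=
    (memLp_id_gaussianReal' 2 (by simp)).const_mul c
  exact h.comp_measurePreserving
    (measurePreserving_eval (fun _ : ZMod d => gaussianReal 0 1) k)

lemma gauss_lin_memLp (d : ℕ) [NeZero d] (b : ZMod d → ℝ) :
    MemLp (fun ε : ZMod d → ℝ => ∑ k, b k * ε k) 2
      (Measure.pi fun _ => gaussianReal 0 1) :=
  memLp_finsetSum _ fun k _ => gauss_coord d (b k) k

lemma gauss_lin_sq (d : ℕ) [NeZero d] (b : ZMod d → ℝ) :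
    ∫ ε : ZMod d → ℝ, (∑ k, b k * ε k) ^ 2 ∂(Measure.pi fun _ => gaussianReal 0 1)
      = ∑ k, b k ^ 2 := by
  have h0 : ∫ ε : ZMod d → ℝ, (∑ k, b k * ε k) ∂(Measure.pi fun _ => gaussianReal 0 1) = 0 := by
    rw [integral_finsetSum _ fun k _ => (gauss_coord d (b k) k).integrable (by norm_num)]
    refine Finset.sum_eq_zero fun k _ => ?_
    have := integral_comp_eval (μ := fun _ : ZMod d => gaussianReal 0 1) (i := k)
      (f := fun x : ℝ => b k * x) (by fun_prop)
    rw [this, integral_const_mul, integral_id_gaussianReal, mul_zero]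
  rw [← variance_of_integral_eq_zero (gauss_lin_memLp d b).aemeasurable h0]
  have := variance_sum_pi (μ := fun _ : ZMod d => gaussianReal 0 1)
    (X := fun k x => b k * x) (fun k => (memLp_id_gaussianReal' 2 (by simp)).const_mul (b k))
  have e : (∑ k, fun ε : ZMod d → ℝ => b k * ε k) = fun ε : ZMod d → ℝ => ∑ k, b k * ε k := by
    ext ε; simp
  rw [e] at this
  rw [this]
  refine Finset.sum_congr rfl fun k _ => ?_
  rw [variance_const_mul, variance_fun_id_gaussianReal]
  simp

noncomputable def muZ (d : ℕ) (σ : ℝ) (j : ZMod d) : ℝ :=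
  1 + 2 * σ - 2 * σ * Real.cos (2 * Real.pi * j.val / d)

lemma muZ_pos (d : ℕ) (σ : ℝ) (hσ : 0 ≤ σ) (j : ZMod d) : 0 < muZ d σ j := by
  unfold muZ
  nlinarith [Real.cos_le_one (2 * Real.pi * j.val / d)]

lemma char_add (d : ℕ) [NeZero d] (j : ZMod d) :
    ZMod.stdAddChar j + ZMod.stdAddChar (-j)
      = 2 * ((Real.cos (2 * Real.pi * j.val / d) : ℝ) : ℂ) := by
  have h1 := ZMod.stdAddChar_coe (N := d) (j.val : ℤ)
  have h2 := ZMod.stdAddChar_coe (N := d) (-(j.val : ℤ))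
  push_cast at h1 h2
  rw [ZMod.natCast_zmod_val] at h1 h2
  rw [h1, h2]
  push_cast
  rw [Complex.two_cos]
  congr 2 <;> ring

lemma A_row (d : ℕ) [NeZero d] (hd : 3 ≤ d) (σ : ℝ) (i : ZMod d) (f : ZMod d → ℂ) :
    ∑ k, ((Aσ d σ i k : ℝ) : ℂ) * f k
      = (1 + 2 * σ) * f i - σ * f (i - 1) - σ * f (i + 1) := by
  have h1 : (1 : ZMod d) ≠ 0 := by
    intro h
    have : ((1 : ℕ) : ZMod d) = 0 := by exact_mod_cast h
    rw [ZMod.natCast_eq_zero_iff] at this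
    have := Nat.le_of_dvd (by norm_num) this
    omega
  have h2 : (2 : ZMod d) ≠ 0 := by
    intro h
    have : ((2 : ℕ) : ZMod d) = 0 := by exact_mod_cast h
    rw [ZMod.natCast_eq_zero_iff] at this
    have := Nat.le_of_dvd (by norm_num) this
    omega
  have key : ∀ k, ((Aσ d σ i k : ℝ) : ℂ) * f k
      = (if k = i then (1 + 2 * σ) * f k else 0) - (if k = i - 1 then σ * f k else 0)
        - (if k = i + 1 then σ * f k else 0) := by
    intro k
    simp only [Aσ, Matrix.of_apply]
    have a1 : i ≠ i - 1 := fun h => h1 (by linear_combination h)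
    have a2 : i ≠ i + 1 := fun h => h1 (by linear_combination -h)
    have a3 : i - 1 ≠ i + 1 := fun h => h2 (by linear_combination -h)
    by_cases hk : k = i
    · subst hk; simp [a1, a2]
    by_cases hk1 : k = i - 1
    · subst hk1; simp [a1, a3, h1]
    by_cases hk2 : k = i + 1
    · subst hk2; simp [a2, hk1, h1]
    have : ¬ i = k + 1 := by grind
    simp [Ne.symm hk, hk, hk1, hk2, this]
  simp only [key, Finset.sum_sub_distrib, Finset.sum_ite_eq', Finset.mem_univ, if_true]

noncomputable def FM (d : ℕ) [NeZero d] : Matrix (ZMod d) (ZMod d) ℂ :=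
  Matrix.of fun i j => ZMod.stdAddChar (i * j)

noncomputable def GM (d : ℕ) [NeZero d] : Matrix (ZMod d) (ZMod d) ℂ :=
  Matrix.of fun i j => (d : ℂ)⁻¹ * ZMod.stdAddChar (-(i * j))

lemma FM_mul_GM (d : ℕ) [NeZero d] : FM d * GM d = 1 := by
  ext i j
  rw [Matrix.mul_apply, Matrix.one_apply]
  have hd : (d : ℂ) ≠ 0 := by exact_mod_cast NeZero.ne d
  have : ∀ k, FM d i k * GM d k j = (d : ℂ)⁻¹ * ZMod.stdAddChar (k * (i - j)) := by
    intro k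
    simp only [FM, GM, Matrix.of_apply]
    rw [mul_left_comm, ← AddChar.map_add_eq_mul]
    congr 2; ring
  simp only [this, ← Finset.mul_sum]
  rw [AddChar.sum_mulShift _ (ZMod.isPrimitive_stdAddChar d)]
  by_cases h : i = j
  · simp [h, hd]
  · simp [h, sub_eq_zero]

lemma A_mul_FM (d : ℕ) [NeZero d] (hd : 3 ≤ d) (σ : ℝ) :
    (Aσ d σ).map Complex.ofRealHom * FM d
      = FM d * Matrix.diagonal (fun j => (muZ d σ j : ℂ)) := by
  ext i j
  rw [Matrix.mul_diagonal, Matrix.mul_apply]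
  have := A_row d hd σ i (fun k => FM d k j)
  simp only [Matrix.map_apply, Complex.ofRealHom_eq_coe]
  rw [this]
  simp only [FM, Matrix.of_apply, sub_mul, add_mul, one_mul]
  rw [sub_eq_add_neg (i * j) j, AddChar.map_add_eq_mul, AddChar.map_add_eq_mul]
  have h := char_add d j
  simp only [muZ]
  push_cast at h ⊢
  linear_combination (-(σ : ℂ) * ZMod.stdAddChar (i * j)) * h

lemma A_symm (d : ℕ) (σ : ℝ) : (Aσ d σ)ᵀ = Aσ d σ := by
  ext i j
  simp only [Aσ, Matrix.transpose_apply, Matrix.of_apply, eq_comm (a := j) (b := i),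
    or_comm (a := j = i + 1)]

lemma sum_sq_inv (d : ℕ) [NeZero d] (hd : 3 ≤ d) (σ : ℝ) (hσ : 0 ≤ σ) :
    ∑ i, ∑ k, ((Aσ d σ)⁻¹ i k) ^ 2 = ∑ j : ZMod d, 1 / (muZ d σ j) ^ 2 := by
  set AC := (Aσ d σ).map Complex.ofRealHom with hAC
  set E : Matrix (ZMod d) (ZMod d) ℂ := Matrix.diagonal (fun j => ((muZ d σ j : ℂ))⁻¹) with hE
  have hFG := FM_mul_GM d
  have hGF : GM d * FM d = 1 := mul_eq_one_comm.mp hFG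
  have hDE : Matrix.diagonal (fun j => (muZ d σ j : ℂ)) * E = 1 := by
    rw [hE, Matrix.diagonal_mul_diagonal, ← Matrix.diagonal_one]
    congr 1
    ext j
    exact mul_inv_cancel₀ (by exact_mod_cast (muZ_pos d σ hσ j).ne')
  have hAB : AC * (FM d * E * GM d) = 1 := by
    rw [← mul_assoc, ← mul_assoc, A_mul_FM d hd, mul_assoc (FM d), hDE, mul_one, hFG]
  have hdet : IsUnit (Aσ d σ).det := by
    have h1 : IsUnit AC.det := Matrix.isUnit_det_of_right_inverse hAB
    have h2 : AC.det = Complex.ofRealHom (Aσ d σ).det := by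
      rw [RingHom.map_det]; rfl
    rw [h2] at h1
    simpa using h1
  have hA1 : AC * (Aσ d σ)⁻¹.map Complex.ofRealHom = 1 := by
    rw [hAC, ← Matrix.map_mul, Matrix.mul_nonsing_inv _ hdet]
    simp
  have hB : (Aσ d σ)⁻¹.map Complex.ofRealHom = FM d * E * GM d :=
    (left_inv_eq_right_inv (mul_eq_one_comm.mp hA1) hAB)
  have hsym : ((Aσ d σ)⁻¹)ᵀ = (Aσ d σ)⁻¹ := by
    rw [Matrix.transpose_nonsing_inv, A_symm]
  have htr : ∑ i, ∑ k, ((Aσ d σ)⁻¹ i k) ^ 2 = ((Aσ d σ)⁻¹ * (Aσ d σ)⁻¹).trace := by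
    simp only [Matrix.trace, Matrix.diag_apply, Matrix.mul_apply]
    refine Finset.sum_congr rfl fun i _ => Finset.sum_congr rfl fun k _ => ?_
    have := congrFun (congrFun hsym i) k
    rw [Matrix.transpose_apply] at this
    rw [this, sq]
  have hC : ((((Aσ d σ)⁻¹ * (Aσ d σ)⁻¹).trace : ℝ) : ℂ)
      = (((Aσ d σ)⁻¹ * (Aσ d σ)⁻¹).map Complex.ofRealHom).trace := by
    simp only [Matrix.trace, Matrix.diag_apply, Matrix.map_apply, Complex.ofRealHom_eq_coe,
      Complex.ofReal_sum]
  rw [htr]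
  apply Complex.ofReal_injective
  rw [hC, Matrix.map_mul, hB]
  have : FM d * E * GM d * (FM d * E * GM d) = FM d * (E * E * GM d) := by
    calc _ = FM d * E * (GM d * FM d) * E * GM d := by simp only [mul_assoc]
      _ = _ := by rw [hGF]; simp only [mul_assoc, one_mul, mul_one]
  rw [this, Matrix.trace_mul_comm, mul_assoc, hGF, mul_one, hE, Matrix.diagonal_mul_diagonal,
    Matrix.trace_diagonal]
  push_cast
  refine Finset.sum_congr rfl fun j _ => ?_
  rw [one_div, sq, mul_inv]

/-- For a standard Gaussian vector `ε`, `E[‖A_σ⁻¹ ε‖₂²] = ∑_j μ_j⁻²` where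
`μ_j = 1 + 2σ - 2σ·cos(2πj/d)`. -/
theorem stmt_9 (d : ℕ) [NeZero d] (hd : 3 ≤ d) (σ : ℝ) (hσ : 0 ≤ σ) :
    ∫ ε, (∑ i : ZMod d, ((Aσ d σ)⁻¹ *ᵥ ε) i ^ 2) ∂(stdGaussian d)
      = ∑ j ∈ Finset.range d,
          1 / (1 + 2 * σ - 2 * σ * Real.cos (2 * Real.pi * j / d)) ^ 2 := by
  have h1 : ∫ ε, (∑ i : ZMod d, ((Aσ d σ)⁻¹ *ᵥ ε) i ^ 2) ∂(stdGaussian d)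
      = ∑ i, ∑ k, ((Aσ d σ)⁻¹ i k) ^ 2 := by
    have h := integral_finsetSum (μ := Measure.pi fun _ : ZMod d => gaussianReal 0 1)
      Finset.univ (f := fun (i : ZMod d) (ε : ZMod d → ℝ) =>
        (∑ k, (Aσ d σ)⁻¹ i k * ε k) ^ 2)
      (fun i _ => (gauss_lin_memLp d (fun k => (Aσ d σ)⁻¹ i k)).integrable_sq)
    refine Eq.trans h ?_
    exact Finset.sum_congr rfl fun i _ => gauss_lin_sq d (fun k => (Aσ d σ)⁻¹ i k)
  rw [h1, sum_sq_inv d hd σ hσ]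
  refine Finset.sum_bij (fun j _ => j.val) ?_ ?_ ?_ ?_
  · intro j _; exact Finset.mem_range.mpr (ZMod.val_lt j)
  · intro a _ b _ h; exact ZMod.val_injective d h
  · intro b hb
    exact ⟨(b : ZMod d), Finset.mem_univ _, ZMod.val_cast_of_lt (Finset.mem_range.mp hb)⟩
  · intro j _; rfl
end

section
/- Let d ≥ 3 be an integer, σ > 0 a real number, and let ε be a standard Gaussian random vector in ℝ^{ZMod d}. Then Laplacian smoothing strictly reduces the expected squared norm of the Gaussian noise: E[‖A_σ⁻¹·ε‖₂²] < E[‖ε‖₂²] = d. Equivalently, Σ_{j=0}^{d−1} (1 + 2σ − 2σ·cos(2πj/d))⁻² < d. -/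
open Matrix MeasureTheory ProbabilityTheory

lemma one_ne_zero_aux (d : ℕ) (hd : 3 ≤ d) : (1 : ZMod d) ≠ 0 := by
  have : Fact (1 < d) := ⟨by omega⟩
  exact one_ne_zero

lemma two_ne_zero_aux (d : ℕ) (hd : 3 ≤ d) : (1 + 1 : ZMod d) ≠ 0 := by
  intro h
  have h2 : ((2 : ℕ) : ZMod d) = 0 := by push_cast; rw [← h]; norm_num
  rw [ZMod.natCast_eq_zero_iff] at h2
  have := Nat.le_of_dvd (by norm_num) h2
  omega

lemma Aσ_mulVec (d : ℕ) [NeZero d] (hd : 3 ≤ d) (σ : ℝ) (y : ZMod d → ℝ) (i : ZMod d) :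
    (Aσ d σ *ᵥ y) i = (1 + 2 * σ) * y i - σ * y (i + 1) - σ * y (i - 1) := by
  have h1 := one_ne_zero_aux d hd
  have h2 := two_ne_zero_aux d hd
  have e : ∀ j, Aσ d σ i j * y j = (if j = i then (1 + 2 * σ) * y j else 0)
      + (if j = i + 1 then -σ * y j else 0) + (if j = i - 1 then -σ * y j else 0) := by
    intro j
    simp only [Aσ, Matrix.of_apply]
    by_cases ha : j = i
    · subst ha
      have : j ≠ j - 1 := fun h => h1 (by linear_combination h)
      simp [h1, this]
    · by_cases hb : j = i + 1
      · subst hb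
        have : i + 1 ≠ i - 1 := by
          intro h
          apply h2
          linear_combination h
        simp [h1, this]
      · by_cases hc : j = i - 1
        · subst hc
          simp [ha, hb, Ne.symm ha]
        · have : i ≠ j + 1 := by
            intro h
            apply hc
            rw [h]; ring
          simp [ha, hb, hc, Ne.symm ha, this]
  simp only [Matrix.mulVec, dotProduct, e, Finset.sum_add_distrib, Finset.sum_ite_eq',
    Finset.mem_univ, if_true]
  ring

lemma key (d : ℕ) [NeZero d] (hd : 3 ≤ d) (σ : ℝ) (y : ZMod d → ℝ) :
    ∑ i, y i ^ 2 + 2 * σ * ∑ i, (y i - y (i + 1)) ^ 2 ≤ ∑ i, (Aσ d σ *ᵥ y) i ^ 2 := by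
  have s1 : ∑ i, y (i + 1) ^ 2 = ∑ i, y i ^ 2 :=
    Equiv.sum_comp (Equiv.addRight (1 : ZMod d)) (fun i => y i ^ 2)
  have s2 : ∑ i, y (i + 1) * y i = ∑ i, y i * y (i - 1) := by
    have := Equiv.sum_comp (Equiv.addRight (1 : ZMod d)) (fun i => y i * y (i - 1))
    simpa using this
  have e : ∑ i, (Aσ d σ *ᵥ y) i ^ 2 = ∑ i, y i ^ 2 + 2 * σ * ∑ i, (y i - y (i + 1)) ^ 2
      + ∑ i, (σ * (2 * y i - y (i + 1) - y (i - 1))) ^ 2 := by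
    have t1 : ∑ i, (y i - y (i + 1)) ^ 2 = ∑ i, (2 * y i ^ 2 - y (i + 1) * y i - y i * y (i - 1)) := by
      have : ∀ i, (y i - y (i + 1)) ^ 2 = y i ^ 2 + y (i + 1) ^ 2 - 2 * (y (i + 1) * y i) := by
        intro i; ring
      simp only [this, Finset.sum_add_distrib, Finset.sum_sub_distrib, ← Finset.mul_sum, s1, ← s2]
      ring
    rw [t1, Finset.mul_sum, ← Finset.sum_add_distrib, ← Finset.sum_add_distrib]
    refine Finset.sum_congr rfl fun i _ => ?_
    rw [Aσ_mulVec d hd]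
    ring
  rw [e]
  have : 0 ≤ ∑ i, (σ * (2 * y i - y (i + 1) - y (i - 1))) ^ 2 :=
    Finset.sum_nonneg fun i _ => sq_nonneg _
  linarith

lemma Aσ_isUnit (d : ℕ) [NeZero d] (hd : 3 ≤ d) (σ : ℝ) (hσ : 0 < σ) : IsUnit (Aσ d σ) := by
  rw [← Matrix.mulVec_injective_iff_isUnit]
  intro x y hxy
  have h0 : Aσ d σ *ᵥ (x - y) = 0 := by rw [Matrix.mulVec_sub]; simpa [sub_eq_zero] using hxy
  have k := key d hd σ (x - y)
  rw [h0] at k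
  have n1 : 0 ≤ ∑ i, ((x - y) i - (x - y) (i + 1)) ^ 2 := Finset.sum_nonneg fun i _ => sq_nonneg _
  have n2 : ∑ i, (x - y) i ^ 2 = 0 := by
    apply le_antisymm
    · simp only [Pi.zero_apply] at k
      have := mul_nonneg hσ.le n1
      simp at k this ⊢
      linarith
    · exact Finset.sum_nonneg fun i _ => sq_nonneg _
  rw [Finset.sum_eq_zero_iff_of_nonneg (fun i _ => sq_nonneg _)] at n2
  funext i
  have := n2 i (Finset.mem_univ i)
  simpa [sub_eq_zero] using this

lemma col_lt (d : ℕ) [NeZero d] (hd : 3 ≤ d) (σ : ℝ) (hσ : 0 < σ) (j : ZMod d) :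
    ∑ i, ((Aσ d σ)⁻¹ i j) ^ 2 < 1 := by
  set y : ZMod d → ℝ := fun i => (Aσ d σ)⁻¹ i j with hy
  have hAy : Aσ d σ *ᵥ y = Pi.single j 1 := by
    have : y = (Aσ d σ)⁻¹ *ᵥ Pi.single j 1 := by
      rw [Matrix.mulVec_single_one]; rfl
    rw [this, Matrix.mulVec_mulVec, Matrix.mul_nonsing_inv _
      ((Matrix.isUnit_iff_isUnit_det _).1 (Aσ_isUnit d hd σ hσ)), Matrix.one_mulVec]
  have k := key d hd σ y
  have e1 : ∑ i, (Aσ d σ *ᵥ y) i ^ 2 = 1 := by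
    rw [hAy]
    simp [Pi.single_apply]
  rw [e1] at k
  have n1 : 0 ≤ ∑ i, (y i - y (i + 1)) ^ 2 := Finset.sum_nonneg fun i _ => sq_nonneg _
  have n2 : ∑ i, (y i - y (i + 1)) ^ 2 ≠ 0 := by
    intro h
    rw [Finset.sum_eq_zero_iff_of_nonneg (fun i _ => sq_nonneg _)] at h
    have hc : ∀ i, y (i + 1) = y i := fun i => by
      have := h i (Finset.mem_univ i)
      have := pow_eq_zero_iff (two_ne_zero) |>.1 this
      linarith
    have hA : ∀ i, (Aσ d σ *ᵥ y) i = y i := by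
      intro i
      rw [Aσ_mulVec d hd, hc i]
      have := hc (i - 1)
      rw [sub_add_cancel] at this
      rw [← this]; ring
    have a1 := hA j
    have a2 := hA (j + 1)
    rw [hAy] at a1 a2
    rw [hc] at a2
    simp [one_ne_zero_aux d hd] at a1 a2
    linarith
  have := mul_pos hσ (lt_of_le_of_ne n1 (Ne.symm n2))
  change ∑ i, y i ^ 2 < 1
  linarith

instance (d : ℕ) [NeZero d] : IsProbabilityMeasure (stdGaussian d) := by
  unfold _root_.stdGaussian; infer_instance

lemma memLp_coord (d : ℕ) [NeZero d] (i : ZMod d) :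
    MemLp (fun ε : ZMod d → ℝ => ε i) 2 (stdGaussian d) :=
  (memLp_id_gaussianReal (μ := 0) (v := 1) 2).comp_measurePreserving
    (measurePreserving_eval (fun _ : ZMod d => gaussianReal 0 1) i)

lemma integrable_mul_coord (d : ℕ) [NeZero d] (i j : ZMod d) :
    Integrable (fun ε : ZMod d → ℝ => ε i * ε j) (stdGaussian d) :=
  (memLp_coord d i).integrable_mul (memLp_coord d j)

lemma integral_mul_coord (d : ℕ) [NeZero d] (i j : ZMod d) :
    ∫ ε, ε i * ε j ∂(stdGaussian d) = if i = j then 1 else 0 := by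
  have hmap : ∀ (i : ZMod d) (f : ℝ → ℝ), Measurable f →
      ∫ ε, f (ε i) ∂(stdGaussian d) = ∫ x, f x ∂(gaussianReal 0 1) := by
    intro i f hf
    have h := measurePreserving_eval (fun _ : ZMod d => gaussianReal 0 1) i
    rw [← h.map_eq, integral_map h.measurable.aemeasurable hf.aestronglyMeasurable]
    rfl
  have hm : ∀ i, ∫ ε, ε i ∂(stdGaussian d) = 0 := by
    intro i
    rw [hmap i (fun x => x) measurable_id, integral_id_gaussianReal]
  split_ifs with h
  · subst h
    rw [hmap i (fun x => x * x) (by fun_prop)]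
    have h1 := variance_of_integral_eq_zero (X := fun x : ℝ => x) (μ := gaussianReal 0 1)
      aemeasurable_id integral_id_gaussianReal
    rw [variance_fun_id_gaussianReal] at h1
    simpa [sq] using h1.symm
  · have := (iIndepFun_pi (μ := fun _ : ZMod d => gaussianReal 0 1) (X := fun _ x => x)
      (fun _ => aemeasurable_id)).indepFun h
    have h2 := this.integral_fun_mul_eq_mul_integral (measurable_pi_apply i).aestronglyMeasurable
      (measurable_pi_apply j).aestronglyMeasurable
    have := hm i
    unfold _root_.stdGaussian at *
    rw [h2, this, zero_mul]

lemma integral_row (d : ℕ) [NeZero d] (B : Matrix (ZMod d) (ZMod d) ℝ) :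
    ∫ ε, (∑ i : ZMod d, (B *ᵥ ε) i ^ 2) ∂(stdGaussian d) = ∑ j, ∑ i, B i j ^ 2 := by
  have e : ∀ ε : ZMod d → ℝ, ∑ i : ZMod d, (B *ᵥ ε) i ^ 2
      = ∑ i, ∑ j, ∑ k, B i j * B i k * (ε j * ε k) := by
    intro ε
    refine Finset.sum_congr rfl fun i _ => ?_
    simp only [Matrix.mulVec, dotProduct, sq, Finset.sum_mul_sum]
    refine Finset.sum_congr rfl fun j _ => Finset.sum_congr rfl fun k _ => by ring
  have hI : ∀ i j k, Integrable (fun ε : ZMod d → ℝ => B i j * B i k * (ε j * ε k))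
      (stdGaussian d) := fun i j k => (integrable_mul_coord d j k).const_mul _
  simp only [e]
  rw [integral_finsetSum _ fun i _ => integrable_finsetSum _ fun j _ =>
    integrable_finsetSum _ fun k _ => hI i j k, Finset.sum_comm]
  refine Finset.sum_congr rfl fun i _ => ?_
  rw [integral_finsetSum _ fun j _ => integrable_finsetSum _ fun k _ => hI i j k]
  refine Finset.sum_congr rfl fun j _ => ?_
  rw [integral_finsetSum _ fun k _ => hI i j k]
  simp [integral_const_mul, integral_mul_coord, sq]

/-- Laplacian smoothing strictly reduces the expected squared norm of a standard Gaussian vector: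
`E[‖A_σ⁻¹ ε‖₂²] < E[‖ε‖₂²] = d`, equivalently `∑_j μ_j⁻² < d`. -/
theorem stmt_11 (d : ℕ) [NeZero d] (hd : 3 ≤ d) (σ : ℝ) (hσ : 0 < σ) :
    (∫ ε, (∑ i : ZMod d, ((Aσ d σ)⁻¹ *ᵥ ε) i ^ 2) ∂(stdGaussian d)
      < ∫ ε, (∑ i : ZMod d, ε i ^ 2) ∂(stdGaussian d))
    ∧ (∫ ε, (∑ i : ZMod d, ε i ^ 2) ∂(stdGaussian d) = d)
    ∧ ∑ j ∈ Finset.range d,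
        (1 + 2 * σ - 2 * σ * Real.cos (2 * Real.pi * j / d))⁻¹ ^ 2 < d := by
  have h2 : ∫ ε, (∑ i : ZMod d, ε i ^ 2) ∂(stdGaussian d) = d := by
    have := integral_row d 1
    simp only [Matrix.one_mulVec] at this
    rw [this]
    simp [Matrix.one_apply, ZMod.card]
  refine ⟨?_, h2, ?_⟩
  · rw [h2, integral_row]
    calc _ < ∑ j : ZMod d, (1 : ℝ) :=
          Finset.sum_lt_sum_of_nonempty Finset.univ_nonempty fun j _ => col_lt d hd σ hσ j
      _ = d := by simp [ZMod.card]
  · have hge : ∀ c : ℝ, c ≤ 1 → (1 + 2 * σ - 2 * σ * c)⁻¹ ^ 2 ≤ 1 := by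
      intro c hc
      have : 1 ≤ 1 + 2 * σ - 2 * σ * c := by nlinarith
      exact pow_le_one₀ (by positivity) (inv_le_one_of_one_le₀ this)
    have hgt : ∀ c : ℝ, c < 1 → (1 + 2 * σ - 2 * σ * c)⁻¹ ^ 2 < 1 := by
      intro c hc
      have : 1 < 1 + 2 * σ - 2 * σ * c := by nlinarith
      exact pow_lt_one₀ (by positivity) (inv_lt_one_of_one_lt₀ this) two_ne_zero
    calc _ < ∑ j ∈ Finset.range d, (1 : ℝ) := by
          refine Finset.sum_lt_sum (fun j _ => hge _ (Real.cos_le_one _))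
            ⟨1, Finset.mem_range.2 (by omega), hgt _ ?_⟩
          rw [← Real.cos_zero]
          have hd' : (3 : ℝ) ≤ d := by exact_mod_cast hd
          apply Real.cos_lt_cos_of_nonneg_of_le_pi le_rfl
          · rw [div_le_iff₀ (by linarith)]
            push_cast
            nlinarith [Real.pi_pos]
          · have := Real.pi_pos
            push_cast
            positivity
      _ = d := by simp
end

section
/- Let d ≥ 1 be an integer and a ∈ ℝ^d. Then the Gaussian mixture potential f_a is dissipative with constants m = 1/2 and b = ‖a‖²/2: for every x ∈ ℝ^d, ⟨∇f_a(x), x⟩ ≥ (1/2)·‖x‖² − (1/2)·‖a‖². -/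
open RealInnerProductSpace

/-- The Gaussian mixture potential `f_a` is `(1/2, ‖a‖²/2)`-dissipative:
`⟨∇f_a(x), x⟩ ≥ ‖x‖²/2 - ‖a‖²/2`. -/
theorem stmt_14 (d : ℕ) (hd : 1 ≤ d) (a : EuclideanSpace ℝ (Fin d))
    (f : EuclideanSpace ℝ (Fin d) → ℝ)
    (hf : ∀ x, f x = ‖x - a‖ ^ 2 / 2
      - Real.log (2 / 3 + (1 / 3) * Real.exp (-2 * ⟪a, x⟫))) :
    ∀ x, ⟪gradient f x, x⟫ ≥ (1 / 2) * ‖x‖ ^ 2 - (1 / 2) * ‖a‖ ^ 2 := by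
  intro x
  have hE := Real.exp_pos (-2 * ⟪a, x⟫)
  have hpos : 0 < 2 / 3 + (1 / 3) * Real.exp (-2 * ⟪a, x⟫) := by positivity
  have h1 : HasFDerivAt (fun y : EuclideanSpace ℝ (Fin d) => ‖y - a‖ ^ 2) _ x :=
    ((hasFDerivAt_id x).sub_const a).norm_sq
  have h2 : HasFDerivAt (fun y : EuclideanSpace ℝ (Fin d) => ⟪a, y⟫) (innerSL ℝ a) x :=
    (innerSL ℝ a).hasFDerivAt
  have h3 := ((((h2.const_mul (-2)).exp).const_mul (1 / 3)).const_add (2 / 3)).log hpos.ne'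
  have h4 := (h1.mul_const (1 / 2)).sub h3
  have h5 : HasFDerivAt f _ x := h4.congr_of_eventuallyEq
    (Filter.Eventually.of_forall fun y => by simp [hf y, div_eq_mul_inv])
  have hg : ⟪gradient f x, x⟫ = fderiv ℝ f x x := by
    rw [gradient, InnerProductSpace.toDual_symm_apply]
  obtain ⟨p, hp⟩ : ∃ p, p = (2 / 3 + (1 / 3) * Real.exp (-2 * ⟪a, x⟫))⁻¹
      * ((1 / 3) * Real.exp (-2 * ⟪a, x⟫)) := ⟨_, rfl⟩
  have hp0 : 0 ≤ p := by rw [hp]; positivity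
  have hp1 : p ≤ 1 := by
    rw [hp, inv_mul_le_iff₀ hpos]; linarith
  have key : ⟪gradient f x, x⟫ = ‖x‖ ^ 2 - (1 - 2 * p) * ⟪a, x⟫ := by
    rw [hg, h5.fderiv, hp, ← real_inner_self_eq_norm_sq]
    simp [inner_sub_left]
    ring
  rw [key]
  have ha : 0 ≤ ‖x‖ ^ 2 + 2 * ⟪a, x⟫ + ‖a‖ ^ 2 := by
    have := norm_add_sq_real a x
    nlinarith [sq_nonneg ‖a + x‖]
  have hb : 0 ≤ ‖x‖ ^ 2 - 2 * ⟪a, x⟫ + ‖a‖ ^ 2 := by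
    have := norm_sub_sq_real a x
    nlinarith [sq_nonneg ‖a - x‖]
  nlinarith [mul_nonneg hp0 ha, mul_nonneg (sub_nonneg.2 hp1) hb]
end

section
/- Let d ≥ 1 be an integer and a ∈ ℝ^d with ‖a‖ > 3/2. Then the Gaussian mixture potential f_a is not convex on ℝ^d. -/
open RealInnerProductSpace

/-- If `‖a‖ > 3/2`, the Gaussian mixture potential `f_a` is not convex on `ℝ^d`. -/
theorem stmt_15 (d : ℕ) (hd : 1 ≤ d) (a : EuclideanSpace ℝ (Fin d)) (ha : ‖a‖ > 3 / 2)
    (f : EuclideanSpace ℝ (Fin d) → ℝ)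
    (hf : ∀ x, f x = ‖x - a‖ ^ 2 / 2
      - Real.log (2 / 3 + (1 / 3) * Real.exp (-2 * ⟪a, x⟫))) :
    ¬ ConvexOn ℝ Set.univ f := by
  intro hc
  obtain ⟨r, hr⟩ : ∃ r, r = ‖a‖ ^ 2 := ⟨_, rfl⟩
  have hr94 : 9 / 4 < r := by rw [hr]; nlinarith
  have hr0 : r ≠ 0 := by linarith
  have key : ∀ t : ℝ, f (t • a) = r * (t - 1) ^ 2 / 2
      - Real.log (2 / 3 + (1 / 3) * Real.exp (-2 * (t * r))) := by
    intro t
    have h1 : t • a - a = (t - 1) • a := by rw [sub_smul, one_smul]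
    rw [hf, h1, norm_smul, mul_pow, real_inner_smul_right, real_inner_self_eq_norm_sq, ← hr,
      Real.norm_eq_abs, sq_abs, mul_comm r]
  obtain ⟨t, ht⟩ : ∃ t, t = -Real.log 2 / (2 * r) := ⟨_, rfl⟩
  have h := hc.2 (Set.mem_univ ((t + 1 / r) • a)) (Set.mem_univ ((t - 1 / r) • a))
    (by norm_num : (0:ℝ) ≤ 1 / 2) (by norm_num : (0:ℝ) ≤ 1 / 2) (by norm_num)
  have hm : (1 / 2 : ℝ) • ((t + 1 / r) • a) + (1 / 2 : ℝ) • ((t - 1 / r) • a) = t • a := by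
    rw [smul_smul, smul_smul, ← add_smul]; congr 1; ring
  have e0 : Real.exp (-2 * (t * r)) = 2 := by
    rw [show -2 * (t * r) = Real.log 2 by rw [ht]; field_simp, Real.exp_log (by norm_num)]
  have e1 : Real.exp (-2 * ((t + 1 / r) * r)) = 2 * Real.exp (-2) := by
    rw [show -2 * ((t + 1 / r) * r) = -2 * (t * r) + (-2) by field_simp; ring, Real.exp_add, e0]
  have e2 : Real.exp (-2 * ((t - 1 / r) * r)) = 2 * Real.exp 2 := by
    rw [show -2 * ((t - 1 / r) * r) = -2 * (t * r) + 2 by field_simp; ring, Real.exp_add, e0]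
  rw [hm, key, key, key, e0, e1, e2, smul_eq_mul, smul_eq_mul] at h
  have p1 := Real.exp_pos (-2)
  have p2 := Real.exp_pos 2
  have pp : Real.exp (-2) * Real.exp 2 = 1 := by rw [← Real.exp_add]; norm_num
  have e7 : 7 ≤ Real.exp 2 := by
    have := Real.exp_one_gt_d9
    rw [show (2:ℝ) = 1 + 1 by norm_num, Real.exp_add]
    nlinarith
  have hl : Real.log 4 ≤ Real.log (2 / 3 + 1 / 3 * (2 * Real.exp (-2)))
      + Real.log (2 / 3 + 1 / 3 * (2 * Real.exp 2)) := by
    rw [← Real.log_mul (by positivity) (by positivity)]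
    apply Real.log_le_log (by norm_num)
    nlinarith
  have h4 : Real.log 4 = 2 * Real.log (2 / 3 + 1 / 3 * 2) + 2 * Real.log (3 / 2) := by
    rw [← mul_add, ← Real.log_mul (by norm_num) (by norm_num),
      show (4:ℝ) = 2 ^ 2 by norm_num, Real.log_pow]
    norm_num
  have h32 : 1 / 3 ≤ Real.log (3 / 2) := by
    have := Real.one_sub_inv_le_log_of_pos (show (0:ℝ) < 3 / 2 by norm_num)
    norm_num at this ⊢; linarith
  have hq : r * (t + 1 / r - 1) ^ 2 + r * (t - 1 / r - 1) ^ 2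
      = 2 * (r * (t - 1) ^ 2) + 2 * (1 / r) := by field_simp; ring
  have hi : 1 / r < 4 / 9 := by
    rw [div_lt_iff₀ (by linarith)]; linarith
  linarith
end
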